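/- arXiv:1103.4148 — 4 statements merged into one kernel-verified Lean document; each statement's English description precedes it below -/
import Mathlib

section
/- Let p be a non-zero real number and let F : ℝ² → ℝ be a twice continuously differentiable function satisfying the wave equation ∂²F/∂x² = ∂²F/∂y². Let K : ℝ² → ℝ be a twice continuously differentiable function solving the integral equation K(x,y) = F(x,y) + p ∫ₓ^∞ F(z,y) K(x,z) dz for all x, y. Assume: (i) for all non-negative integers k, s, n with k + s + n ≤ 2, (∂^k F/∂z^k)(z,y) · (∂^{s+n}K/∂x^s∂z^n)(x,z) → 0 as z → ∞; (ii) the improper integrals ∫ₓ^∞ ∂^α_x ∂^β_y ∂^ω_z [F(z,y)K(x,z)] dz converge uniformly on compact sets for all α + β + ω ≤ 2; (iii) for every x, the operator I − A_x is injective, i.e. the only continuous function φ with ∫ₓ^∞ |F(z,y)φ(z)| dz < ∞ satisfying φ(y) = p ∫ₓ^∞ F(z,y) φ(z) dz for all y is φ = 0. Then K satisfies the non-linear partial differential equation ∂²K/∂x²(x,y) − ∂²K/∂y²(x,y) + 2p·K(x,y)·(d/dx)[x ↦ K(x,x)] = 0 for all x, y, where (d/dx)[x ↦ K(x,x)] denotes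 the derivative of the diagonal function x ↦ K(x,x). -/
open MeasureTheory Filter

/-- Partial derivative in the first argument of a function of two real variables. -/
noncomputable def d1₁₂ (G : ℝ → ℝ → ℝ) : ℝ → ℝ → ℝ :=
  fun a b => deriv (fun t => G t b) a

/-- Partial derivative in the second argument of a function of two real variables. -/
noncomputable def d2₁₂ (G : ℝ → ℝ → ℝ) : ℝ → ℝ → ℝ :=
  fun a b => deriv (fun t => G a t) b

/-- Partial derivative in the first argument of a function of three real variables. -/
noncomputable def e1₁₂ (H : ℝ → ℝ → ℝ → ℝ) : ℝ → ℝ → ℝ → ℝ :=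
  fun a b c => deriv (fun t => H t b c) a

/-- Partial derivative in the second argument of a function of three real variables. -/
noncomputable def e2₁₂ (H : ℝ → ℝ → ℝ → ℝ) : ℝ → ℝ → ℝ → ℝ :=
  fun a b c => deriv (fun t => H a t c) b

/-- Partial derivative in the third argument of a function of three real variables. -/
noncomputable def e3₁₂ (H : ℝ → ℝ → ℝ → ℝ) : ℝ → ℝ → ℝ → ℝ :=
  fun a b c => deriv (fun t => H a b t) c

/-- A smooth approximation of the absolute value. -/
noncomputable def smoothAbs (ε s : ℝ) : ℝ := √(s ^ 2 + ε ^ 2)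

/-- The derivative of `smoothAbs ε`, a smooth approximation of the sign. -/
noncomputable def smoothSign (ε s : ℝ) : ℝ := s / smoothAbs ε s

lemma smoothAbs_sq (ε s : ℝ) : smoothAbs ε s ^ 2 = s ^ 2 + ε ^ 2 :=
  Real.sq_sqrt (by positivity)

lemma smoothAbs_pos {ε : ℝ} (hε : 0 < ε) (s : ℝ) : 0 < smoothAbs ε s :=
  Real.sqrt_pos.2 (by positivity)

lemma abs_le_smoothAbs (ε s : ℝ) : |s| ≤ smoothAbs ε s :=
  Real.abs_le_sqrt (by nlinarith [sq_nonneg ε])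

lemma le_smoothAbs (ε s : ℝ) : ε ≤ smoothAbs ε s :=
  (le_abs_self ε).trans (Real.abs_le_sqrt (by nlinarith [sq_nonneg s]))

lemma smoothAbs_le {ε : ℝ} (hε : 0 < ε) (s : ℝ) : smoothAbs ε s ≤ |s| + ε := by
  refine Real.sqrt_le_iff.2 ⟨by positivity, ?_⟩
  nlinarith [sq_abs s, abs_nonneg s]

lemma abs_smoothSign_le (ε s : ℝ) : |smoothSign ε s| ≤ 1 := by
  have h : 0 ≤ smoothAbs ε s := Real.sqrt_nonneg _
  rw [smoothSign, abs_div, abs_of_nonneg h]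
  exact div_le_one_of_le₀ (abs_le_smoothAbs ε s) h

lemma hasDerivAt_smoothAbs {ε : ℝ} (hε : 0 < ε) (s : ℝ) :
    HasDerivAt (smoothAbs ε) (smoothSign ε s) s := by
  refine (((hasDerivAt_pow 2 s).add_const (ε ^ 2)).sqrt (by positivity)).congr_deriv ?_
  rw [smoothSign, smoothAbs, Nat.cast_ofNat, pow_one]
  exact mul_div_mul_left _ _ two_ne_zero

lemma hasDerivAt_smoothSign {ε : ℝ} (hε : 0 < ε) (s : ℝ) :
    HasDerivAt (smoothSign ε) (ε ^ 2 / smoothAbs ε s ^ 3) s := by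
  have h0 := (smoothAbs_pos hε s).ne'
  refine ((hasDerivAt_id s).div (hasDerivAt_smoothAbs hε s) h0).congr_deriv ?_
  simp only [id, smoothSign]
  have := smoothAbs_sq ε s
  field_simp
  linarith

lemma continuous_smoothAbs (ε : ℝ) : Continuous (smoothAbs ε) := by
  unfold smoothAbs; fun_prop

lemma continuous_smoothSign {ε : ℝ} (hε : 0 < ε) : Continuous (smoothSign ε) :=
  continuous_id.div (continuous_smoothAbs ε) fun s => (smoothAbs_pos hε s).ne'

lemma abs_smoothAbs_sub_le {ε : ℝ} (hε : 0 < ε) (a b : ℝ) :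
    |smoothAbs ε a - smoothAbs ε b| ≤ |a - b| := by
  have := Convex.norm_image_sub_le_of_norm_hasDerivWithin_le (f := smoothAbs ε) (C := 1)
    (fun x _ => (hasDerivAt_smoothAbs hε x).hasDerivWithinAt)
    (fun x _ => abs_smoothSign_le ε x) convex_univ (Set.mem_univ b) (Set.mem_univ a)
  simpa using this

lemma abs_mul_deriv_smoothSign_le {ε : ℝ} (hε : 0 < ε) (s : ℝ) :
    |s| * (ε ^ 2 / smoothAbs ε s ^ 3) ≤ 1 := by
  have h0 := smoothAbs_pos hε s
  rw [← mul_div_assoc, div_le_one (by positivity)]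
  calc |s| * ε ^ 2 ≤ smoothAbs ε s * smoothAbs ε s ^ 2 := by
        gcongr
        · exact abs_le_smoothAbs ε s
        · exact le_smoothAbs ε s
    _ = _ := by ring

lemma tendsto_smoothSign {s : ℝ} (hs : s ≠ 0) :
    Tendsto (fun ε => smoothSign ε s) (nhdsWithin 0 (Set.Ioi 0)) (nhds (s / |s|)) := by
  have h : ContinuousAt (fun ε => smoothSign ε s) 0 := by
    unfold smoothSign smoothAbs
    refine ContinuousAt.div (by fun_prop) (by fun_prop) ?_
    exact (Real.sqrt_pos.2 (by positivity)).ne'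
  have := h.tendsto.mono_left (nhdsWithin_le_nhds (s := Set.Ioi 0))
  simpa [smoothSign, smoothAbs, Real.sqrt_sq_eq_abs] using this

lemma tendsto_abs_mul_deriv_smoothSign (s : ℝ) :
    Tendsto (fun ε => |s| * (ε ^ 2 / smoothAbs ε s ^ 3)) (nhdsWithin 0 (Set.Ioi 0)) (nhds 0) := by
  rcases eq_or_ne s 0 with rfl | hs
  · simp
  have h : ContinuousAt (fun ε => |s| * (ε ^ 2 / smoothAbs ε s ^ 3)) 0 := by
    unfold smoothAbs
    refine ContinuousAt.mul (by fun_prop) (ContinuousAt.div (by fun_prop) (by fun_prop) ?_)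
    exact pow_ne_zero _ (Real.sqrt_pos.2 (by positivity)).ne'
  simpa using h.tendsto.mono_left (nhdsWithin_le_nhds (s := Set.Ioi 0))

lemma integral_abs_deriv_mul_deriv_le {f f₁ f₂ u u₁ u₂ : ℝ → ℝ}
    (hf : ∀ t, HasDerivAt f (f₁ t) t) (hf₁ : ∀ t, HasDerivAt f₁ (f₂ t) t) (hf₂ : Continuous f₂)
    (hu : ∀ t, HasDerivAt u (u₁ t) t) (hu₁ : ∀ t, HasDerivAt u₁ (u₂ t) t) (hu₂ : Continuous u₂)
    {x T : ℝ} (hT : x ≤ T) :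
    ∫ t in x..T, |f₁ t * u₁ t| ≤ |f₁ x * u x| + |f₁ T * u T|
      + ∫ t in x..T, (|f₂ t * u t + 2 * (f₁ t * u₁ t) + f t * u₂ t|
        + 2 * |2 * (f₁ t * u₁ t) + f t * u₂ t|) := by
  have cf : Continuous f := continuous_iff_continuousAt.2 fun t => (hf t).continuousAt
  have cf₁ : Continuous f₁ := continuous_iff_continuousAt.2 fun t => (hf₁ t).continuousAt
  have cu : Continuous u := continuous_iff_continuousAt.2 fun t => (hu t).continuousAt
  have cu₁ : Continuous u₁ := continuous_iff_continuousAt.2 fun t => (hu₁ t).continuousAt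
  set L : ℝ → ℝ → ℝ := fun ε t =>
    smoothSign ε (f t * f₁ t) * smoothSign ε (f t * u₁ t) * (f₁ t * u₁ t)
      - (|f₁ t * u₁ t| + |f₂ t * u t|) *
        (|f t * f₁ t| * (ε ^ 2 / smoothAbs ε (f t * f₁ t) ^ 3)) with hL
  set L₀ : ℝ → ℝ := fun t => if f t = 0 then 0 else |f₁ t * u₁ t| with hL₀
  have cL : ∀ ε > 0, Continuous (L ε) := by
    intro ε hε
    have c1 := continuous_smoothSign hε
    have c2 := continuous_smoothAbs ε
    have c3 : Continuous fun t => ε ^ 2 / smoothAbs ε (f t * f₁ t) ^ 3 :=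
      Continuous.div (by fun_prop) (by fun_prop) fun t => pow_ne_zero _ (smoothAbs_pos hε _).ne'
    simp only [hL]
    fun_prop
  have bound : ∀ ε > 0, ∫ t in x..T, L ε t ≤ |f₁ x * u x| + |f₁ T * u T|
      + ∫ t in x..T, (|f₂ t * u t + 2 * (f₁ t * u₁ t) + f t * u₂ t|
        + |2 * (f₁ t * u₁ t) + f t * u₂ t|) := by
    intro ε hε
    set Φ : ℝ → ℝ := fun t => smoothSign ε (f t * f₁ t) *
      (smoothAbs ε (f₁ t * u t + f t * u₁ t) - smoothAbs ε (f t * u₁ t)) with hΦ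
    have c1 := continuous_smoothSign hε
    have c2 := continuous_smoothAbs ε
    have c3 : Continuous fun t => ε ^ 2 / smoothAbs ε (f t * f₁ t) ^ 3 :=
      Continuous.div (by fun_prop) (by fun_prop) fun t => pow_ne_zero _ (smoothAbs_pos hε _).ne'
    set D : ℝ → ℝ := fun t =>
      (ε ^ 2 / smoothAbs ε (f t * f₁ t) ^ 3 * (f₁ t * f₁ t + f t * f₂ t)) *
        (smoothAbs ε (f₁ t * u t + f t * u₁ t) - smoothAbs ε (f t * u₁ t)) +
      smoothSign ε (f t * f₁ t) *
        (smoothSign ε (f₁ t * u t + f t * u₁ t) *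
            ((f₂ t * u t + f₁ t * u₁ t) + (f₁ t * u₁ t + f t * u₂ t))
          - smoothSign ε (f t * u₁ t) * (f₁ t * u₁ t + f t * u₂ t)) with hD
    have hderiv : ∀ t, HasDerivAt Φ (D t) t := by
      intro t
      have h1 := (hasDerivAt_smoothSign hε (f t * f₁ t)).comp t ((hf t).mul (hf₁ t))
      have h2 := (hasDerivAt_smoothAbs hε (f₁ t * u t + f t * u₁ t)).comp t
        (((hf₁ t).mul (hu t)).add ((hf t).mul (hu₁ t)))
      have h3 := (hasDerivAt_smoothAbs hε (f t * u₁ t)).comp t ((hf t).mul (hu₁ t))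
      exact h1.mul (h2.sub h3)
    have cD : Continuous D := by simp only [hD]; fun_prop
    have hFTC : ∫ t in x..T, D t = Φ T - Φ x :=
      intervalIntegral.integral_eq_sub_of_hasDerivAt (fun t _ => hderiv t)
        (cD.intervalIntegrable _ _)
    have hΦle : ∀ t, |Φ t| ≤ |f₁ t * u t| := by
      intro t
      rw [hΦ, abs_mul]
      have := abs_smoothAbs_sub_le hε (f₁ t * u t + f t * u₁ t) (f t * u₁ t)
      rw [add_sub_cancel_right] at this
      calc _ ≤ 1 * |f₁ t * u t| := by
            gcongr
            exact abs_smoothSign_le _ _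
        _ = _ := one_mul _
    have hpt : ∀ t, L ε t - (|f₂ t * u t + 2 * (f₁ t * u₁ t) + f t * u₂ t|
        + |2 * (f₁ t * u₁ t) + f t * u₂ t|) ≤ D t := by
      intro t
      have hN := abs_smoothAbs_sub_le hε (f₁ t * u t + f t * u₁ t) (f t * u₁ t)
      rw [add_sub_cancel_right] at hN
      have hN' : -|f t * u₁ t| ≤
          smoothAbs ε (f₁ t * u t + f t * u₁ t) - smoothAbs ε (f t * u₁ t) := by
        linarith [le_smoothAbs ε (f₁ t * u t + f t * u₁ t), smoothAbs_le hε (f t * u₁ t)]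
      have hτ1 := abs_smoothSign_le ε (f t * f₁ t)
      have hτ2 := abs_smoothSign_le ε (f t * u₁ t)
      have hτ3 := abs_smoothSign_le ε (f₁ t * u t + f t * u₁ t)
      have hτ' : 0 ≤ ε ^ 2 / smoothAbs ε (f t * f₁ t) ^ 3 := by
        have := smoothAbs_pos hε (f t * f₁ t)
        positivity
      simp only [hL, hD]
      generalize smoothAbs ε (f₁ t * u t + f t * u₁ t) - smoothAbs ε (f t * u₁ t) = N at *
      generalize ε ^ 2 / smoothAbs ε (f t * f₁ t) ^ 3 = w at *
      generalize smoothSign ε (f t * f₁ t) = a at *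
      generalize smoothSign ε (f t * u₁ t) = b at *
      generalize smoothSign ε (f₁ t * u t + f t * u₁ t) = c at *
      generalize f t = f at *
      generalize f₁ t = f₁ at *
      generalize f₂ t = f₂ at *
      generalize u t = u at *
      generalize u₁ t = u₁ at *
      generalize u₂ t = u₂ at *
      have e1 : -(|f₁ * u₁| * (|f * f₁| * w)) ≤ w * (f₁ * f₁) * N := by
        have : w * (f₁ * f₁) * (-|f * u₁|) ≤ w * (f₁ * f₁) * N :=
          mul_le_mul_of_nonneg_left hN' (mul_nonneg hτ' (mul_self_nonneg _))
        refine le_trans (le_of_eq ?_) this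
        rw [abs_mul, abs_mul, abs_mul, ← abs_mul_abs_self f₁]
        ring
      have e2 : -(|f₂ * u| * (|f * f₁| * w)) ≤ w * (f * f₂) * N := by
        have : |w * (f * f₂) * N| ≤ |w * (f * f₂)| * |f₁ * u| := by
          rw [abs_mul]; gcongr
        have h2 := neg_abs_le (w * (f * f₂) * N)
        have : |w * (f * f₂)| * |f₁ * u| = |f₂ * u| * (|f * f₁| * w) := by
          simp only [abs_mul, abs_of_nonneg hτ']; ring
        linarith
      have e3 : -|f₂ * u + 2 * (f₁ * u₁) + f * u₂| ≤
          (a * c) * (f₂ * u + 2 * (f₁ * u₁) + f * u₂) := by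
        refine le_trans (neg_le_neg ?_) (neg_abs_le _)
        rw [abs_mul, abs_mul]
        exact mul_le_of_le_one_left (abs_nonneg _) (mul_le_one₀ hτ1 (abs_nonneg _) hτ3)
      have e4 : -|2 * (f₁ * u₁) + f * u₂| ≤ -((a * b) * (2 * (f₁ * u₁) + f * u₂)) := by
        refine neg_le_neg (le_trans (le_abs_self _) ?_)
        rw [abs_mul, abs_mul]
        exact mul_le_of_le_one_left (abs_nonneg _) (mul_le_one₀ hτ1 (abs_nonneg _) hτ2)
      linarith
    have hE : IntervalIntegrable (fun t => |f₂ t * u t + 2 * (f₁ t * u₁ t) + f t * u₂ t|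
        + |2 * (f₁ t * u₁ t) + f t * u₂ t|) volume x T :=
      Continuous.intervalIntegrable (by fun_prop) _ _
    have hmono := intervalIntegral.integral_mono_on hT
      (((cL ε hε).intervalIntegrable (μ := volume) x T).sub hE)
      (cD.intervalIntegrable _ _) fun t _ => hpt t
    rw [intervalIntegral.integral_sub ((cL ε hε).intervalIntegrable _ _) hE, hFTC] at hmono
    have := hΦle x
    have := hΦle T
    have := neg_abs_le (Φ x)
    have := le_abs_self (Φ T)
    linarith
  have hlim : Tendsto (fun ε => ∫ t in x..T, L ε t) (nhdsWithin 0 (Set.Ioi 0))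
      (nhds (∫ t in x..T, L₀ t)) := by
    refine intervalIntegral.tendsto_integral_filter_of_dominated_convergence
      (fun t => |f₁ t * u₁ t| + (|f₁ t * u₁ t| + |f₂ t * u t|)) ?_ ?_
      (Continuous.intervalIntegrable (by fun_prop) _ _) ?_
    · filter_upwards [self_mem_nhdsWithin] with ε hε
      exact (cL ε hε).aestronglyMeasurable
    · filter_upwards [self_mem_nhdsWithin] with ε hε
      refine Eventually.of_forall fun t _ => ?_
      have h1 := abs_mul_deriv_smoothSign_le hε (f t * f₁ t)
      have hτ' : 0 ≤ ε ^ 2 / smoothAbs ε (f t * f₁ t) ^ 3 := by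
        have := smoothAbs_pos hε (f t * f₁ t)
        positivity
      refine (norm_sub_le _ _).trans (add_le_add ?_ ?_)
      · rw [norm_mul, norm_mul]
        exact mul_le_of_le_one_left (abs_nonneg _)
          (mul_le_one₀ (abs_smoothSign_le _ _) (abs_nonneg _) (abs_smoothSign_le _ _))
      · rw [Real.norm_of_nonneg (by positivity)]
        exact mul_le_of_le_one_right (by positivity) h1
    · refine Eventually.of_forall fun t _ => ?_
      have h2 := (tendsto_abs_mul_deriv_smoothSign (f t * f₁ t)).const_mul
        (|f₁ t * u₁ t| + |f₂ t * u t|)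
      rw [mul_zero] at h2
      rw [← sub_zero (L₀ t)]
      refine Tendsto.sub ?_ h2
      simp only [hL₀]
      by_cases h0 : f t = 0
      · simp [h0, smoothSign]
      by_cases h1 : f₁ t = 0
      · simp [h0, h1]
      by_cases h3 : u₁ t = 0
      · simp [h0, h3]
      rw [if_neg h0]
      have := ((tendsto_smoothSign (mul_ne_zero h0 h1)).mul
        (tendsto_smoothSign (mul_ne_zero h0 h3))).mul_const (f₁ t * u₁ t)
      convert this using 2
      have a0 := abs_ne_zero.2 h0
      have a1 := abs_ne_zero.2 h1
      have a3 := abs_ne_zero.2 h3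
      simp only [abs_mul]
      field_simp
      rw [sq_abs, sq_abs, sq_abs]
      ring
  have hle := le_of_tendsto hlim (by
    filter_upwards [self_mem_nhdsWithin] with ε hε using bound ε hε)
  have hL₀int : IntervalIntegrable L₀ volume x T := by
    have c : Continuous fun t => |f₁ t * u₁ t| := by fun_prop
    have hm : MeasurableSet {t | f t = 0} := (isClosed_eq cf continuous_const).measurableSet
    refine (c.intervalIntegrable x T).mono_fun
      (Measurable.ite hm measurable_const c.measurable).aestronglyMeasurable
      (Eventually.of_forall fun t => ?_)
    simp only [hL₀]
    split_ifs <;> simp only [norm_zero, abs_abs, Real.norm_eq_abs, le_refl, abs_nonneg]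
  have hcmp : ∫ t in x..T, (|f₁ t * u₁ t| - |2 * (f₁ t * u₁ t) + f t * u₂ t|) ≤
      ∫ t in x..T, L₀ t := by
    refine intervalIntegral.integral_mono_on hT
      (Continuous.intervalIntegrable (by fun_prop) _ _) hL₀int fun t _ => ?_
    simp only [hL₀]
    split_ifs with h
    · rw [h, zero_mul, add_zero, abs_mul 2, abs_two]
      linarith [abs_nonneg (f₁ t * u₁ t)]
    · linarith [abs_nonneg (2 * (f₁ t * u₁ t) + f t * u₂ t)]
  have i1 : IntervalIntegrable (fun t => |f₁ t * u₁ t|) volume x T :=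
    Continuous.intervalIntegrable (by fun_prop) _ _
  have i2 : IntervalIntegrable (fun t => |2 * (f₁ t * u₁ t) + f t * u₂ t|) volume x T :=
    Continuous.intervalIntegrable (by fun_prop) _ _
  have i3 : IntervalIntegrable (fun t => |f₂ t * u t + 2 * (f₁ t * u₁ t) + f t * u₂ t|)
    volume x T := Continuous.intervalIntegrable (by fun_prop) _ _
  rw [intervalIntegral.integral_sub i1 i2] at hcmp
  rw [intervalIntegral.integral_add i3 i2] at hle
  rw [intervalIntegral.integral_add i3 (i2.const_mul 2), intervalIntegral.integral_const_mul]
  linarith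

lemma integrableOn_deriv_mul_deriv {f f₁ f₂ u u₁ u₂ : ℝ → ℝ}
    (hf : ∀ t, HasDerivAt f (f₁ t) t) (hf₁ : ∀ t, HasDerivAt f₁ (f₂ t) t) (hf₂ : Continuous f₂)
    (hu : ∀ t, HasDerivAt u (u₁ t) t) (hu₁ : ∀ t, HasDerivAt u₁ (u₂ t) t) (hu₂ : Continuous u₂)
    {x : ℝ} (h₁ : IntegrableOn (fun t => f₂ t * u t) (Set.Ioi x))
    (h₂ : IntegrableOn (fun t => f₂ t * u t + 2 * (f₁ t * u₁ t) + f t * u₂ t) (Set.Ioi x))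
    (hlim : Tendsto (fun t => f₁ t * u t) atTop (nhds 0)) :
    IntegrableOn (fun t => f₁ t * u₁ t) (Set.Ioi x) := by
  have cf₁ : Continuous f₁ := continuous_iff_continuousAt.2 fun t => (hf₁ t).continuousAt
  have cu₁ : Continuous u₁ := continuous_iff_continuousAt.2 fun t => (hu₁ t).continuousAt
  have h₃ : IntegrableOn (fun t => 2 * (f₁ t * u₁ t) + f t * u₂ t) (Set.Ioi x) := by
    refine (h₂.sub h₁).congr (Eventually.of_forall fun t => ?_)
    simp only [Pi.sub_apply]
    ring
  have h₄ : IntegrableOn (fun t => |f₂ t * u t + 2 * (f₁ t * u₁ t) + f t * u₂ t|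
      + 2 * |2 * (f₁ t * u₁ t) + f t * u₂ t|) (Set.Ioi x) := h₂.abs.add (h₃.abs.const_mul 2)
  refine integrableOn_Ioi_of_intervalIntegral_norm_bounded (b := id) (l := atTop)
    (|f₁ x * u x| + 1 + ∫ t in Set.Ioi x, (|f₂ t * u t + 2 * (f₁ t * u₁ t) + f t * u₂ t|
      + 2 * |2 * (f₁ t * u₁ t) + f t * u₂ t|)) x
    (fun T => (Continuous.integrableOn_Ioc (by fun_prop))) tendsto_id ?_
  have hsmall : ∀ᶠ t in atTop, |f₁ t * u t| ≤ 1 :=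
    (hlim.abs.eventually (ge_mem_nhds (by simp)))
  filter_upwards [hsmall, eventually_ge_atTop x] with T h1 hT
  refine (integral_abs_deriv_mul_deriv_le hf hf₁ hf₂ hu hu₁ hu₂ hT).trans ?_
  rw [intervalIntegral.integral_of_le hT]
  have := setIntegral_mono_set h₄ (Eventually.of_forall fun t => by positivity)
    (Set.Ioc_subset_Ioi_self : Set.Ioc x T ⊆ Set.Ioi x).eventuallyLE
  linarith

lemma hasDerivAt_intervalIntegral_param {H H' : ℝ → ℝ → ℝ}
    (hd : ∀ t z, HasDerivAt (fun t => H t z) (H' t z) t)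
    (hH : Continuous fun q : ℝ × ℝ => H q.1 q.2) (hH' : Continuous fun q : ℝ × ℝ => H' q.1 q.2)
    (a b x : ℝ) :
    HasDerivAt (fun t => ∫ z in a..b, H t z) (∫ z in a..b, H' x z) x := by
  obtain ⟨C, hC⟩ := ((isCompact_Icc (a := x - 1) (b := x + 1)).prod
    (isCompact_uIcc (a := a) (b := b))).exists_bound_of_continuousOn hH'.continuousOn
  have c : ∀ t, Continuous fun z => H t z := fun t => hH.comp (by fun_prop : Continuous (t, ·))
  have c' : ∀ t, Continuous fun z => H' t z := fun t => hH'.comp (by fun_prop : Continuous (t, ·))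
  refine (intervalIntegral.hasDerivAt_integral_of_dominated_loc_of_deriv_le
    (s := Set.Icc (x - 1) (x + 1)) (bound := fun _ => C) (Icc_mem_nhds (by linarith) (by linarith))
    (Eventually.of_forall fun t => (c t).aestronglyMeasurable)
    ((c x).intervalIntegrable _ _) (c' x).aestronglyMeasurable
    (Eventually.of_forall fun z hz t ht => hC (t, z) ⟨ht, Set.uIoc_subset_uIcc hz⟩)
    intervalIntegrable_const (Eventually.of_forall fun z _ t _ => hd t z)).2

lemma hasDerivAt_integral_diag {H : ℝ → ℝ → ℝ}
    (hH : Continuous fun q : ℝ × ℝ => H q.1 q.2) (x : ℝ) :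
    HasDerivAt (fun t => ∫ z in x..t, H t z) (H x x) x := by
  have c : ∀ t, Continuous fun z => H t z := fun t => hH.comp (by fun_prop : Continuous (t, ·))
  rw [hasDerivAt_iff_isLittleO, Asymptotics.isLittleO_iff]
  intro ε hε
  obtain ⟨δ, hδ, hball⟩ := Metric.continuousAt_iff.1 (hH.continuousAt (x := (x, x))) ε hε
  filter_upwards [Metric.ball_mem_nhds x hδ] with t ht
  have e : (∫ z in x..t, H t z) - (∫ z in x..x, H x z) - (t - x) • H x x
      = ∫ z in x..t, (H t z - H x x) := by
    rw [intervalIntegral.integral_sub ((c t).intervalIntegrable _ _) intervalIntegrable_const]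
    simp
  rw [e]
  refine intervalIntegral.norm_integral_le_of_norm_le_const fun z hz => ?_
  refine (hball (x := (t, z)) ?_).le
  have hz' : |z - x| ≤ |t - x| := Set.abs_sub_left_of_mem_uIcc (Set.uIoc_subset_uIcc hz)
  rw [Prod.dist_eq]
  exact max_lt ht (lt_of_le_of_lt hz' ht)

lemma hasDerivAt_intervalIntegral_param_left {H H' : ℝ → ℝ → ℝ}
    (hd : ∀ t z, HasDerivAt (fun t => H t z) (H' t z) t)
    (hH : Continuous fun q : ℝ × ℝ => H q.1 q.2) (hH' : Continuous fun q : ℝ × ℝ => H' q.1 q.2)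
    (b x : ℝ) :
    HasDerivAt (fun t => ∫ z in t..b, H t z) (-H x x + ∫ z in x..b, H' x z) x := by
  have c : ∀ t, Continuous fun z => H t z := fun t => hH.comp (by fun_prop : Continuous (t, ·))
  refine (((hasDerivAt_intervalIntegral_param hd hH hH' x b x).sub
    (hasDerivAt_integral_diag hH x)).congr_deriv (by ring)).congr_of_eventuallyEq
    (Eventually.of_forall fun t => ?_)
  exact (intervalIntegral.integral_interval_sub_left ((c t).intervalIntegrable _ _)
    ((c t).intervalIntegrable _ _)).symm

lemma hasDerivAt_integral_Ioi_param {H H' : ℝ → ℝ → ℝ}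
    (hd : ∀ t z, HasDerivAt (fun t => H t z) (H' t z) t)
    (hH : Continuous fun q : ℝ × ℝ => H q.1 q.2) (hH' : Continuous fun q : ℝ × ℝ => H' q.1 q.2)
    (a : ℝ) (hint : ∀ t, IntegrableOn (H t) (Set.Ioi a))
    (hunif : ∀ x, TendstoUniformlyOn (fun b t => ∫ z in Set.Ioc a b, H' t z)
      (fun t => ∫ z in Set.Ioi a, H' t z) atTop (Set.Ioo (x - 1) (x + 1))) (x : ℝ) :
    HasDerivAt (fun t => ∫ z in Set.Ioi a, H t z) (∫ z in Set.Ioi a, H' x z) x := by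
  refine hasDerivAt_of_tendstoUniformlyOn (f := fun b t => ∫ z in a..b, H t z) isOpen_Ioo
    ((hunif x).congr ?_)
    (Eventually.of_forall fun b t _ => hasDerivAt_intervalIntegral_param hd hH hH' a b t)
    (fun t _ => intervalIntegral_tendsto_integral_Ioi a (hint t) tendsto_id)
    ⟨by linarith, by linarith⟩
  filter_upwards [eventually_ge_atTop a] with b hb t _
  exact (intervalIntegral.integral_of_le hb).symm

lemma hasDerivAt_integral_Ioi_param_left {H H' : ℝ → ℝ → ℝ}
    (hd : ∀ t z, HasDerivAt (fun t => H t z) (H' t z) t)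
    (hH : Continuous fun q : ℝ × ℝ => H q.1 q.2) (hH' : Continuous fun q : ℝ × ℝ => H' q.1 q.2)
    (hint : ∀ t, IntegrableOn (H t) (Set.Ioi t))
    (hunif : ∀ x, TendstoUniformlyOn (fun b t => ∫ z in Set.Ioc t b, H' t z)
      (fun t => ∫ z in Set.Ioi t, H' t z) atTop (Set.Ioo (x - 1) (x + 1))) (x : ℝ) :
    HasDerivAt (fun t => ∫ z in Set.Ioi t, H t z) (-H x x + ∫ z in Set.Ioi x, H' x z) x := by
  refine hasDerivAt_of_tendstoUniformlyOn (f := fun b t => ∫ z in t..b, H t z)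
    (f' := fun b t => -H t t + ∫ z in t..b, H' t z)
    (g' := fun t => -H t t + ∫ z in Set.Ioi t, H' t z) (s := Set.Ioo (x - 1) (x + 1)) isOpen_Ioo ?_
    (Eventually.of_forall fun b t _ => hasDerivAt_intervalIntegral_param_left hd hH hH' b t)
    (fun t _ => intervalIntegral_tendsto_integral_Ioi t (hint t) tendsto_id)
    ⟨by linarith, by linarith⟩
  rw [Metric.tendstoUniformlyOn_iff]
  intro ε hε
  filter_upwards [Metric.tendstoUniformlyOn_iff.1 (hunif x) ε hε, eventually_ge_atTop (x + 1)]
    with b hb hxb t ht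
  rw [dist_add_left, intervalIntegral.integral_of_le (ht.2.le.trans hxb)]
  exact hb t ht

lemma hasDerivAt_d1₁₂ {G : ℝ → ℝ → ℝ} (hG : ContDiff ℝ 1 fun q : ℝ × ℝ => G q.1 q.2) (a b : ℝ) :
    HasDerivAt (fun t => G t b) (d1₁₂ G a b) a := by
  have h : Differentiable ℝ fun t => G t b :=
    (hG.comp (by fun_prop : ContDiff ℝ 1 fun t : ℝ => (t, b))).differentiable one_ne_zero
  exact (h a).hasDerivAt

lemma hasDerivAt_d2₁₂ {G : ℝ → ℝ → ℝ} (hG : ContDiff ℝ 1 fun q : ℝ × ℝ => G q.1 q.2) (a b : ℝ) :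
    HasDerivAt (fun t => G a t) (d2₁₂ G a b) b := by
  have h : Differentiable ℝ fun t => G a t :=
    (hG.comp (by fun_prop : ContDiff ℝ 1 fun t : ℝ => (a, t))).differentiable one_ne_zero
  exact (h b).hasDerivAt

lemma d1₁₂_eq_fderiv {G : ℝ → ℝ → ℝ} (hG : ContDiff ℝ 1 fun q : ℝ × ℝ => G q.1 q.2) (a b : ℝ) :
    d1₁₂ G a b = fderiv ℝ (fun q : ℝ × ℝ => G q.1 q.2) (a, b) (1, 0) :=
  ((hG.differentiable one_ne_zero (a, b)).hasFDerivAt.comp_hasDerivAt (f := fun t => (t, b)) a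
    ((hasDerivAt_id a).prodMk (hasDerivAt_const a b))).deriv

lemma d2₁₂_eq_fderiv {G : ℝ → ℝ → ℝ} (hG : ContDiff ℝ 1 fun q : ℝ × ℝ => G q.1 q.2) (a b : ℝ) :
    d2₁₂ G a b = fderiv ℝ (fun q : ℝ × ℝ => G q.1 q.2) (a, b) (0, 1) :=
  ((hG.differentiable one_ne_zero (a, b)).hasFDerivAt.comp_hasDerivAt (f := fun t => (a, t)) b
    ((hasDerivAt_const b a).prodMk (hasDerivAt_id b))).deriv

lemma contDiff_d1₁₂ {G : ℝ → ℝ → ℝ} {n : WithTop ℕ∞}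
    (hG : ContDiff ℝ (n + 1) fun q : ℝ × ℝ => G q.1 q.2) :
    ContDiff ℝ n fun q : ℝ × ℝ => d1₁₂ G q.1 q.2 := by
  simp only [d1₁₂_eq_fderiv (hG.of_le le_add_self)]
  exact (hG.fderiv_right le_rfl).clm_apply contDiff_const

lemma contDiff_d2₁₂ {G : ℝ → ℝ → ℝ} {n : WithTop ℕ∞}
    (hG : ContDiff ℝ (n + 1) fun q : ℝ × ℝ => G q.1 q.2) :
    ContDiff ℝ n fun q : ℝ × ℝ => d2₁₂ G q.1 q.2 := by
  simp only [d2₁₂_eq_fderiv (hG.of_le le_add_self)]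
  exact (hG.fderiv_right le_rfl).clm_apply contDiff_const

lemma hasDerivAt_diag {G : ℝ → ℝ → ℝ} (hG : ContDiff ℝ 1 fun q : ℝ × ℝ => G q.1 q.2) (a : ℝ) :
    HasDerivAt (fun t => G t t) (d1₁₂ G a a + d2₁₂ G a a) a := by
  have h := (hG.differentiable one_ne_zero (a, a)).hasFDerivAt.comp_hasDerivAt
    (f := fun t => (t, t)) a ((hasDerivAt_id a).prodMk (hasDerivAt_id a))
  refine h.congr_deriv ?_
  rw [d1₁₂_eq_fderiv hG, d2₁₂_eq_fderiv hG, ← map_add]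
  simp

/-- Equation (6) of Example 8 in the real scalar case: a `C²` solution `K` of the linear
integral equation `K(x,y) = F(x,y) + p ∫ₓ^∞ F(z,y) K(x,z) dz`, where `F` solves the wave
equation, satisfies the non-linear equation
`∂²K/∂x² − ∂²K/∂y² + 2p·K(x,y)·(d/dx)[x ↦ K(x,x)] = 0`. -/
theorem stmt_12 (p : ℝ) (hp : p ≠ 0) (F K : ℝ → ℝ → ℝ)
    (hF : ContDiff ℝ 2 (fun q : ℝ × ℝ => F q.1 q.2))
    (hK : ContDiff ℝ 2 (fun q : ℝ × ℝ => K q.1 q.2))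
    (hwave : ∀ x y : ℝ, d1₁₂ (d1₁₂ F) x y = d2₁₂ (d2₁₂ F) x y)
    (hinteq : ∀ x y : ℝ, K x y = F x y + p * ∫ z in Set.Ioi x, F z y * K x z)
    (hdecay : ∀ (x y : ℝ) (k s n : ℕ), k + s + n ≤ 2 →
      Tendsto (fun z => (d1₁₂^[k] F) z y * (d1₁₂^[s] (d2₁₂^[n] K)) x z) atTop (nhds 0))
    (hint : ∀ α β ω : ℕ, α + β + ω ≤ 2 → ∀ x y : ℝ,
      IntegrableOn
        (fun z => (e1₁₂^[α] (e2₁₂^[β] (e3₁₂^[ω] (fun x' y' z' => F z' y' * K x' z')))) x y z)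
        (Set.Ioi x))
    (hunif : ∀ α β ω : ℕ, α + β + ω ≤ 2 → ∀ C : Set (ℝ × ℝ), IsCompact C →
      TendstoUniformlyOn
        (fun (b : ℝ) (q : ℝ × ℝ) => ∫ z in Set.Ioc q.1 b,
          (e1₁₂^[α] (e2₁₂^[β] (e3₁₂^[ω] (fun x' y' z' => F z' y' * K x' z')))) q.1 q.2 z)
        (fun q => ∫ z in Set.Ioi q.1,
          (e1₁₂^[α] (e2₁₂^[β] (e3₁₂^[ω] (fun x' y' z' => F z' y' * K x' z')))) q.1 q.2 z)
        atTop C)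
    (hinj : ∀ (x : ℝ) (φ : ℝ → ℝ), Continuous φ →
      (∀ y : ℝ, IntegrableOn (fun z => |F z y * φ z|) (Set.Ioi x)) →
      (∀ y : ℝ, φ y = p * ∫ z in Set.Ioi x, F z y * φ z) → ∀ y : ℝ, φ y = 0) :
    ∀ x y : ℝ,
      d1₁₂ (d1₁₂ K) x y - d2₁₂ (d2₁₂ K) x y
        + 2 * p * K x y * deriv (fun t => K t t) x = 0 := by
  have hF1 : ContDiff ℝ 1 fun q : ℝ × ℝ => F q.1 q.2 := hF.of_le one_le_two
  have hK1 : ContDiff ℝ 1 fun q : ℝ × ℝ => K q.1 q.2 := hK.of_le one_le_two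
  have hF' : ContDiff ℝ (1 + 1) fun q : ℝ × ℝ => F q.1 q.2 := by rwa [one_add_one_eq_two]
  have hK' : ContDiff ℝ (1 + 1) fun q : ℝ × ℝ => K q.1 q.2 := by rwa [one_add_one_eq_two]
  have hFx := contDiff_d1₁₂ hF'
  have hFy := contDiff_d2₁₂ hF'
  have hKx := contDiff_d1₁₂ hK'
  have hKy := contDiff_d2₁₂ hK'
  have hFxx : Continuous fun q : ℝ × ℝ => d1₁₂ (d1₁₂ F) q.1 q.2 :=
    (contDiff_d1₁₂ (by rwa [zero_add])).continuous (n := 0)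
  have hFyy : Continuous fun q : ℝ × ℝ => d2₁₂ (d2₁₂ F) q.1 q.2 :=
    (contDiff_d2₁₂ (by rwa [zero_add])).continuous (n := 0)
  have hKxx : Continuous fun q : ℝ × ℝ => d1₁₂ (d1₁₂ K) q.1 q.2 :=
    (contDiff_d1₁₂ (by rwa [zero_add])).continuous (n := 0)
  have hKyy : Continuous fun q : ℝ × ℝ => d2₁₂ (d2₁₂ K) q.1 q.2 :=
    (contDiff_d2₁₂ (by rwa [zero_add])).continuous (n := 0)
  have cF := hF.continuous
  have cK := hK.continuous
  have cFy := hFy.continuous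
  have cKx := hKx.continuous
  have E100 : e1₁₂^[1] (e2₁₂^[0] (e3₁₂^[0] fun x y z => F z y * K x z))
      = fun x y z => F z y * d1₁₂ K x z := by
    funext x y z
    exact deriv_const_mul_field _
  have E200 : e1₁₂^[2] (e2₁₂^[0] (e3₁₂^[0] fun x y z => F z y * K x z))
      = fun x y z => F z y * d1₁₂ (d1₁₂ K) x z := by
    change e1₁₂ (e1₁₂^[1] (e2₁₂^[0] (e3₁₂^[0] fun x y z => F z y * K x z))) = _
    rw [E100]
    funext x y z
    exact deriv_const_mul_field _
  have E010 : e1₁₂^[0] (e2₁₂^[1] (e3₁₂^[0] fun x y z => F z y * K x z))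
      = fun x y z => d2₁₂ F z y * K x z := by
    funext x y z
    exact deriv_mul_const_field _
  have E020 : e1₁₂^[0] (e2₁₂^[2] (e3₁₂^[0] fun x y z => F z y * K x z))
      = fun x y z => d2₁₂ (d2₁₂ F) z y * K x z := by
    change e2₁₂ (e1₁₂^[0] (e2₁₂^[1] (e3₁₂^[0] fun x y z => F z y * K x z))) = _
    rw [E010]
    funext x y z
    exact deriv_mul_const_field _
  have E002 : e1₁₂^[0] (e2₁₂^[0] (e3₁₂^[2] fun x y z => F z y * K x z))
      = fun x y z => d1₁₂ (d1₁₂ F) z y * K x z + 2 * (d1₁₂ F z y * d2₁₂ K x z)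
        + F z y * d2₁₂ (d2₁₂ K) x z := by
    have e : e3₁₂ (fun x y z => F z y * K x z)
        = fun x y z => d1₁₂ F z y * K x z + F z y * d2₁₂ K x z := by
      funext x y z
      exact ((hasDerivAt_d1₁₂ hF1 z y).mul (hasDerivAt_d2₁₂ hK1 x z)).deriv
    change e3₁₂ (e3₁₂ fun x y z => F z y * K x z) = _
    rw [e]
    funext x y z
    refine ((((hasDerivAt_d1₁₂ hFx z y).mul (hasDerivAt_d2₁₂ hK1 x z)).add
      ((hasDerivAt_d1₁₂ hF1 z y).mul (hasDerivAt_d2₁₂ hKy x z))).congr_deriv ?_).deriv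
    ring
  have i000 : ∀ x y, IntegrableOn (fun z => F z y * K x z) (Set.Ioi x) :=
    hint 0 0 0 (by norm_num)
  have i100 := hint 1 0 0 (by norm_num)
  have i200 := hint 2 0 0 (by norm_num)
  have i010 := hint 0 1 0 (by norm_num)
  have i020 := hint 0 2 0 (by norm_num)
  have i002 := hint 0 0 2 (by norm_num)
  simp only [E100] at i100
  simp only [E200] at i200
  simp only [E010] at i010
  simp only [E020] at i020
  simp only [E002] at i002
  have u100 := hunif 1 0 0 (by norm_num)
  have u200 := hunif 2 0 0 (by norm_num)
  have u010 := hunif 0 1 0 (by norm_num)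
  have u020 := hunif 0 2 0 (by norm_num)
  simp only [E100] at u100
  simp only [E200] at u200
  simp only [E010] at u010
  simp only [E020] at u020
  have dKx : ∀ x y, d1₁₂ K x y =
      d1₁₂ F x y + p * (-(F x y * K x x) + ∫ z in Set.Ioi x, F z y * d1₁₂ K x z) := by
    intro x y
    have h := hasDerivAt_integral_Ioi_param_left (H := fun t z => F z y * K t z)
      (H' := fun t z => F z y * d1₁₂ K t z)
      (fun t z => (hasDerivAt_d1₁₂ hK1 t z).const_mul _) (by fun_prop) (by fun_prop)
      (fun t => i000 t y)
      (fun x => ((u100 _ (isCompact_Icc.prod isCompact_singleton)).comp (fun t => (t, y))).mono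
        fun t ht => ⟨Set.Ioo_subset_Icc_self ht, rfl⟩) x
    have h2 := (hasDerivAt_d1₁₂ hF1 x y).add (h.const_mul p)
    exact (h2.congr_of_eventuallyEq (Eventually.of_forall fun t => hinteq t y)).deriv
  have dKxx : ∀ x y, d1₁₂ (d1₁₂ K) x y = d1₁₂ (d1₁₂ F) x y
      + p * (-(d1₁₂ F x y * K x x + F x y * (d1₁₂ K x x + d2₁₂ K x x))
        + (-(F x y * d1₁₂ K x x) + ∫ z in Set.Ioi x, F z y * d1₁₂ (d1₁₂ K) x z)) := by
    intro x y
    have h := hasDerivAt_integral_Ioi_param_left (H := fun t z => F z y * d1₁₂ K t z)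
      (H' := fun t z => F z y * d1₁₂ (d1₁₂ K) t z)
      (fun t z => (hasDerivAt_d1₁₂ hKx t z).const_mul _) (by fun_prop) (by fun_prop)
      (fun t => i100 t y)
      (fun x => ((u200 _ (isCompact_Icc.prod isCompact_singleton)).comp (fun t => (t, y))).mono
        fun t ht => ⟨Set.Ioo_subset_Icc_self ht, rfl⟩) x
    have h2 := (hasDerivAt_d1₁₂ hFx x y).add
      ((((hasDerivAt_d1₁₂ hF1 x y).mul (hasDerivAt_diag hK1 x)).neg.add h).const_mul p)
    exact (h2.congr_of_eventuallyEq (Eventually.of_forall fun t => dKx t y)).deriv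
  have dKy : ∀ x y, d2₁₂ K x y = d2₁₂ F x y + p * ∫ z in Set.Ioi x, d2₁₂ F z y * K x z := by
    intro x y
    have h := hasDerivAt_integral_Ioi_param (H := fun t z => F z t * K x z)
      (H' := fun t z => d2₁₂ F z t * K x z)
      (fun t z => (hasDerivAt_d2₁₂ hF1 z t).mul_const _) (by fun_prop) (by fun_prop) x
      (fun t => i000 x t)
      (fun y => ((u010 _ (isCompact_singleton.prod isCompact_Icc)).comp (fun t => (x, t))).mono
        fun t ht => ⟨rfl, Set.Ioo_subset_Icc_self ht⟩) y
    have h2 := (hasDerivAt_d2₁₂ hF1 x y).add (h.const_mul p)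
    exact (h2.congr_of_eventuallyEq (Eventually.of_forall fun t => hinteq x t)).deriv
  have dKyy : ∀ x y, d2₁₂ (d2₁₂ K) x y =
      d2₁₂ (d2₁₂ F) x y + p * ∫ z in Set.Ioi x, d2₁₂ (d2₁₂ F) z y * K x z := by
    intro x y
    have h := hasDerivAt_integral_Ioi_param (H := fun t z => d2₁₂ F z t * K x z)
      (H' := fun t z => d2₁₂ (d2₁₂ F) z t * K x z)
      (fun t z => (hasDerivAt_d2₁₂ hFy z t).mul_const _) (by fun_prop) (by fun_prop) x
      (fun t => i010 x t)
      (fun y => ((u020 _ (isCompact_singleton.prod isCompact_Icc)).comp (fun t => (x, t))).mono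
        fun t ht => ⟨rfl, Set.Ioo_subset_Icc_self ht⟩) y
    have h2 := (hasDerivAt_d2₁₂ hFy x y).add (h.const_mul p)
    exact (h2.congr_of_eventuallyEq (Eventually.of_forall fun t => dKy x t)).deriv
  have hlim₁ : ∀ x y, Tendsto (fun z => d1₁₂ F z y * K x z) atTop (nhds 0) :=
    fun x y => hdecay x y 1 0 0 (by norm_num)
  have hlim₂ : ∀ x y, Tendsto (fun z => F z y * d2₁₂ K x z) atTop (nhds 0) :=
    fun x y => hdecay x y 0 0 1 (by norm_num)
  simp only [← hwave] at i020 dKyy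
  have iFKyy : ∀ x y, IntegrableOn (fun z => F z y * d2₁₂ (d2₁₂ K) x z) (Set.Ioi x) := by
    intro x y
    have h := integrableOn_deriv_mul_deriv (fun z => hasDerivAt_d1₁₂ hF1 z y)
      (fun z => hasDerivAt_d1₁₂ hFx z y) (by fun_prop) (fun z => hasDerivAt_d2₁₂ hK1 x z)
      (fun z => hasDerivAt_d2₁₂ hKy x z) (by fun_prop) (i020 x y) (i002 x y) (hlim₁ x y)
    refine (((i002 x y).sub (i020 x y)).sub (h.const_mul 2)).congr
      (Eventually.of_forall fun z => ?_)
    simp only [Pi.sub_apply]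
    ring
  have hparts : ∀ x y, ∫ z in Set.Ioi x, d1₁₂ (d1₁₂ F) z y * K x z =
      (∫ z in Set.Ioi x, F z y * d2₁₂ (d2₁₂ K) x z)
        - d1₁₂ F x y * K x x + F x y * d2₁₂ K x x := by
    intro x y
    have h := integral_Ioi_of_hasDerivAt_of_tendsto' (a := x) (m := 0)
      (f := fun z => d1₁₂ F z y * K x z - F z y * d2₁₂ K x z)
      (f' := fun z => d1₁₂ (d1₁₂ F) z y * K x z - F z y * d2₁₂ (d2₁₂ K) x z)
      (fun z _ => (((hasDerivAt_d1₁₂ hFx z y).mul (hasDerivAt_d2₁₂ hK1 x z)).sub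
        ((hasDerivAt_d1₁₂ hF1 z y).mul (hasDerivAt_d2₁₂ hKy x z))).congr_deriv (by ring))
      ((i020 x y).sub (iFKyy x y)) (by simpa using (hlim₁ x y).sub (hlim₂ x y))
    rw [integral_sub (i020 x y) (iFKyy x y)] at h
    linarith
  intro x
  rw [(hasDerivAt_diag hK1 x).deriv]
  set c := d1₁₂ K x x + d2₁₂ K x x
  have iφ : ∀ y, IntegrableOn (fun z => F z y *
      (d1₁₂ (d1₁₂ K) x z - d2₁₂ (d2₁₂ K) x z + 2 * p * K x z * c)) (Set.Ioi x) := by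
    intro y
    refine (((i200 x y).sub (iFKyy x y)).add ((i000 x y).const_mul (2 * p * c))).congr
      (Eventually.of_forall fun z => ?_)
    simp only [Pi.sub_apply, Pi.add_apply]
    ring
  refine hinj x (fun y => d1₁₂ (d1₁₂ K) x y - d2₁₂ (d2₁₂ K) x y + 2 * p * K x y * c)
    (by fun_prop) (fun y => (iφ y).abs) fun y => ?_
  have e : ∫ z in Set.Ioi x, F z y *
      (d1₁₂ (d1₁₂ K) x z - d2₁₂ (d2₁₂ K) x z + 2 * p * K x z * c) =
      (∫ z in Set.Ioi x, F z y * d1₁₂ (d1₁₂ K) x z)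
        - (∫ z in Set.Ioi x, F z y * d2₁₂ (d2₁₂ K) x z)
        + 2 * p * c * ∫ z in Set.Ioi x, F z y * K x z := by
    have isub : IntegrableOn (fun z => F z y * d1₁₂ (d1₁₂ K) x z - F z y * d2₁₂ (d2₁₂ K) x z)
        (Set.Ioi x) := (i200 x y).sub (iFKyy x y)
    rw [← integral_const_mul, ← integral_sub (i200 x y) (iFKyy x y),
      ← integral_add isub ((i000 x y).const_mul _)]
    refine integral_congr_ae (Eventually.of_forall fun z => ?_)
    ring
  rw [e, dKxx, dKyy, hparts, hinteq x y]
  ring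
end

section
/- Work in the complexified quaternion algebra ℍ_ℂ = ℍ ⊗_ℝ ℂ, whose center contains the complex unit I, and embed the quaternion units i₀ = 1, i₁, i₂, i₃ in it. Fix permutations ξ₁, ξ₂ of {0,1,2,3}, real constants ψ₁⁰,…,ψ₁³ and ψ₂¹, ψ₂², ψ₂³ (with ψ₂⁰ = 0), a real number p ≠ 0, and a quaternion k = k₀ + k₁i₁ + k₂i₂ + k₃i₃. Define the operators σ₁ (in the variable x ∈ ℝ⁴) and σ₂ (in the variable y ∈ ℝ⁴) on differentiable ℍ_ℂ-valued functions by σ₁f = Σ_{j=0}^{3} iⱼ*·(∂f/∂x_{ξ₁(j)})·ψ₁ʲ and σ₂f = Σ_{j=1}^{3} iⱼ*·(∂f/∂y_{ξ₂(j)})·ψ₂ʲ. Let Φ : ℝ⁴ → ℍ_ℂ be twice continuously differentiable, let w : ℝ⁴ → ℍ_ℂ be a given function, and set K(x,y) = Φ(x)·exp(I·Re(k·y)), where Re(k·y) = k₀y₀ − k₁y₁ − k₂y₂ − k₃y₃. If (σ₁²K)(x,y) − (σ₂²K)(x,y) + p·K(x,y)·w(x) = 0 for all x, y ∈ ℝ⁴,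 then Φ satisfies the Schrödinger-type equation (σ₁²Φ)(x) + Φ(x)·(p·w(x) − Σ_{j=1}^{3} (ψ₂ʲ)² k_{ξ₂(j)}²) = 0 for all x ∈ ℝ⁴. -/
/-- Partial derivative in the `j`-th coordinate direction of a `ℂ`-valued function on `ℝ⁴`. -/
noncomputable def pdc13 (j : Fin 4) (f : (Fin 4 → ℝ) → ℂ) : (Fin 4 → ℝ) → ℂ :=
  fun x => fderiv ℝ f x (Pi.single j 1)

/-- Componentwise partial derivative in the `j`-th coordinate direction of a function on `ℝ⁴`
with values in the complexified quaternions `ℍ_ℂ = Quaternion ℂ`. -/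
noncomputable def pdQ13 (j : Fin 4) (f : (Fin 4 → ℝ) → Quaternion ℂ) :
    (Fin 4 → ℝ) → Quaternion ℂ :=
  fun x => ⟨pdc13 j (fun y => (f y).re) x, pdc13 j (fun y => (f y).imI) x,
    pdc13 j (fun y => (f y).imJ) x, pdc13 j (fun y => (f y).imK) x⟩

/-- The quaternion units `i₀ = 1, i₁, i₂, i₃` inside the biquaternions `ℍ_ℂ`. -/
noncomputable def qeC : Fin 4 → Quaternion ℂ := ![1, ⟨0,1,0,0⟩, ⟨0,0,1,0⟩, ⟨0,0,0,1⟩]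

/-- The operator `σ f = Σ_{j ∈ s} iⱼ* · (∂f/∂x_{ξ(j)}) · ψⱼ` on `ℍ_ℂ`-valued functions,
with summation over a subset `s` of indices. -/
noncomputable def sigma13 (ξ : Equiv.Perm (Fin 4)) (ψ : Fin 4 → ℝ) (s : Finset (Fin 4))
    (f : (Fin 4 → ℝ) → Quaternion ℂ) : (Fin 4 → ℝ) → Quaternion ℂ :=
  fun x => ∑ j ∈ s, ψ j • (star (qeC j) * pdQ13 (ξ j) f x)

theorem biquaternion_mul_smul (c : ℂ) (a b : Quaternion ℂ) : a * c • b = c • (a * b) := by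
  ext <;> simp <;> ring

theorem biquaternion_smul_mul (c : ℂ) (a b : Quaternion ℂ) : (c • a) * b = c • (a * b) := by
  ext <;> simp <;> ring

theorem biquaternion_mul_real_smul (c : ℝ) (a b : Quaternion ℂ) :
    a * c • b = c • (a * b) := by
  ext <;> simp <;> ring

theorem biquaternion_real_smul (c : ℝ) (q : Quaternion ℂ) : c • q = (c : ℂ) • q := by
  ext <;> simp

/-- The plane wave `exp (I · Σ κⱼ yⱼ)` on `ℝ⁴`. -/
noncomputable def planeWave (κ : Fin 4 → ℝ) (y : Fin 4 → ℝ) : ℂ :=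
  Complex.exp (Complex.I * ((∑ i, κ i * y i : ℝ) : ℂ))

theorem pdc13_planeWave_mul (κ : Fin 4 → ℝ) (j : Fin 4) (a : ℂ) (y : Fin 4 → ℝ) :
    pdc13 j (fun y' => planeWave κ y' * a) y = planeWave κ y * (Complex.I * (κ j * a)) := by
  have hsum : HasFDerivAt (fun y : Fin 4 → ℝ => ∑ i, κ i * y i)
      (∑ i, κ i • ContinuousLinearMap.proj (R := ℝ) (φ := fun _ : Fin 4 => ℝ) i) y :=
    HasFDerivAt.fun_sum fun i _ => (hasFDerivAt_apply i y).const_mul (κ i)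
  have hwave := ((((Complex.ofRealCLM.hasFDerivAt).comp y hsum).const_mul Complex.I).cexp).mul_const a
  unfold pdc13
  erw [hwave.fderiv]
  simp [planeWave, Pi.single_apply]
  ring

theorem pdQ13_planeWave_smul (κ : Fin 4 → ℝ) (j : Fin 4) (q : Quaternion ℂ) (y : Fin 4 → ℝ) :
    pdQ13 j (fun y' => planeWave κ y' • q) y
      = planeWave κ y • (Complex.I • ((κ j : ℂ) • q)) := by
  ext <;> simp [pdQ13, pdc13_planeWave_mul]

/-- The symbol of `sigma13 ξ ψ s` at the frequency `κ`. -/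
noncomputable def sigmaSymbol (ξ : Equiv.Perm (Fin 4)) (ψ : Fin 4 → ℝ) (s : Finset (Fin 4))
    (κ : Fin 4 → ℝ) : Quaternion ℂ :=
  ∑ j ∈ s, ((ψ j * κ (ξ j) : ℝ) : ℂ) • star (qeC j)

theorem sigma13_planeWave_smul (ξ : Equiv.Perm (Fin 4)) (ψ : Fin 4 → ℝ) (s : Finset (Fin 4))
    (κ : Fin 4 → ℝ) (q : Quaternion ℂ) :
    sigma13 ξ ψ s (fun y => planeWave κ y • q)
      = fun y => planeWave κ y • (Complex.I • (sigmaSymbol ξ ψ s κ * q)) := by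
  funext y
  simp only [sigma13, sigmaSymbol, pdQ13_planeWave_smul, Finset.sum_mul, Finset.smul_sum]
  refine Finset.sum_congr rfl fun j _ => ?_
  simp only [biquaternion_real_smul, biquaternion_mul_smul, biquaternion_smul_mul, smul_smul]
  congr 1
  push_cast
  ring

theorem sigmaSymbol_mul_self (ξ : Equiv.Perm (Fin 4)) (ψ κ : Fin 4 → ℝ) :
    sigmaSymbol ξ ψ {1, 2, 3} κ * sigmaSymbol ξ ψ {1, 2, 3} κ
      = (-1 : ℂ) • algebraMap ℝ (Quaternion ℂ)
          (∑ j ∈ ({1, 2, 3} : Finset (Fin 4)), (ψ j) ^ 2 * (κ (ξ j)) ^ 2) := by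
  have hS : sigmaSymbol ξ ψ {1, 2, 3} κ
      = ⟨0, -(ψ 1 * κ (ξ 1)), -(ψ 2 * κ (ξ 2)), -(ψ 3 * κ (ξ 3))⟩ := by
    ext <;> simp [sigmaSymbol] <;> simp [qeC]
  have hN : ∀ c : ℝ, algebraMap ℝ (Quaternion ℂ) c = ⟨c, 0, 0, 0⟩ := fun _ => rfl
  rw [show ∑ j ∈ ({1, 2, 3} : Finset (Fin 4)), (ψ j) ^ 2 * (κ (ξ j)) ^ 2
    = (ψ 1) ^ 2 * (κ (ξ 1)) ^ 2 + (ψ 2) ^ 2 * (κ (ξ 2)) ^ 2 + (ψ 3) ^ 2 * (κ (ξ 3)) ^ 2 by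
      simp [add_assoc]]
  ext <;>
    simp only [Quaternion.re_mul, Quaternion.imI_mul, Quaternion.imJ_mul, Quaternion.imK_mul,
      Quaternion.re_smul, Quaternion.imI_smul, Quaternion.imJ_smul, Quaternion.imK_smul] <;>
    simp only [hS, hN, smul_eq_mul] <;> push_cast <;> ring

theorem sigma13_sigma13_planeWave_smul (ξ : Equiv.Perm (Fin 4)) (ψ κ : Fin 4 → ℝ)
    (q : Quaternion ℂ) (y : Fin 4 → ℝ) :
    sigma13 ξ ψ {1, 2, 3} (sigma13 ξ ψ {1, 2, 3} (fun y => planeWave κ y • q)) y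
      = planeWave κ y • (algebraMap ℝ (Quaternion ℂ)
          (∑ j ∈ ({1, 2, 3} : Finset (Fin 4)), (ψ j) ^ 2 * (κ (ξ j)) ^ 2) * q) := by
  rw [sigma13_planeWave_smul, sigma13_planeWave_smul]
  simp only [biquaternion_mul_smul, ← mul_assoc, sigmaSymbol_mul_self]
  rw [biquaternion_smul_mul, smul_smul Complex.I, Complex.I_mul_I, smul_smul (-1 : ℂ),
    neg_mul_neg, one_mul, one_smul]

/-- Dirac's reduction: if `K(x,y) = Φ(x)·exp(I·Re(k·y))` satisfies the hyperbolic equation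
`σ₁²K − σ₂²K + p·K·w = 0`, then `Φ` satisfies the Schrödinger-type equation
`σ₁²Φ + Φ·(p·w − Σ_{j=1}^{3} (ψ₂ʲ)² k_{ξ₂(j)}²) = 0`. -/
theorem stmt_13 (ξ₁ ξ₂ : Equiv.Perm (Fin 4)) (ψ₁ ψ₂ : Fin 4 → ℝ) (hψ₂0 : ψ₂ 0 = 0)
    (p : ℝ) (hp : p ≠ 0) (k : Fin 4 → ℝ)
    (Φ : (Fin 4 → ℝ) → Quaternion ℂ)
    (hΦ : ContDiff ℝ 2 (fun x => (Φ x).re) ∧ ContDiff ℝ 2 (fun x => (Φ x).imI) ∧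
          ContDiff ℝ 2 (fun x => (Φ x).imJ) ∧ ContDiff ℝ 2 (fun x => (Φ x).imK))
    (w : (Fin 4 → ℝ) → Quaternion ℂ)
    (K : (Fin 4 → ℝ) → (Fin 4 → ℝ) → Quaternion ℂ)
    (hKdef : ∀ x y, K x y = Φ x *
      algebraMap ℂ (Quaternion ℂ)
        (Complex.exp (Complex.I * ((k 0 * y 0 - k 1 * y 1 - k 2 * y 2 - k 3 * y 3 : ℝ) : ℂ))))
    (heq : ∀ x y,
      sigma13 ξ₁ ψ₁ Finset.univ (sigma13 ξ₁ ψ₁ Finset.univ (fun x' => K x' y)) x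
        - sigma13 ξ₂ ψ₂ {1, 2, 3} (sigma13 ξ₂ ψ₂ {1, 2, 3} (fun y' => K x y')) y
        + p • (K x y * w x) = 0) :
    ∀ x, sigma13 ξ₁ ψ₁ Finset.univ (sigma13 ξ₁ ψ₁ Finset.univ Φ) x
      + Φ x * (p • w x - algebraMap ℝ (Quaternion ℂ)
          (∑ j ∈ ({1, 2, 3} : Finset (Fin 4)), (ψ₂ j) ^ 2 * (k (ξ₂ j)) ^ 2)) = 0 := by
  intro x
  let κ : Fin 4 → ℝ := ![k 0, -k 1, -k 2, -k 3]
  have hκ : ∀ j, κ j ^ 2 = k j ^ 2 := by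
    intro j
    fin_cases j <;> simp [κ]
  have hwave : ∀ x y, K x y = planeWave κ y • Φ x := by
    intro x y
    rw [hKdef, ← Algebra.commutes, ← Algebra.smul_def, planeWave]
    simp only [Fin.sum_univ_four]
    congr 4
    simp [κ]
    ring
  have hzero : planeWave κ 0 = 1 := by simp [planeWave]
  have h := heq x 0
  simp only [hwave, sigma13_sigma13_planeWave_smul, hzero, one_smul, hκ] at h
  rw [Algebra.commutes] at h
  rw [mul_sub, biquaternion_mul_real_smul, ← h]
  abel
end

section
/- Let K : ℝ³ → ℝ, written K(x,y,t), be four times continuously differentiable and satisfy, for all x, y, t, the equation ∂K/∂t + (∂/∂x + ∂/∂y)³K + 6·((∂/∂x + ∂/∂y)K)(x,y,t)·(∂/∂x)[x ↦ K(x,x,t)] = 0, where (∂/∂x)[x ↦ K(x,x,t)] denotes the derivative of the diagonal function x ↦ K(x,x,t). Then the function u(x,t) := 2·(∂/∂x)[x ↦ K(x,x,t)] satisfies the Korteweg–de Vries equation ∂u/∂t + 3·∂(u²)/∂x + ∂³u/∂x³ = 0, i.e. u_t + 6 u u_x + u_{xxx} = 0. -/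
/-- Partial derivative in the first argument of a function of three real variables. -/
noncomputable def d1₁₅ (G : ℝ → ℝ → ℝ → ℝ) : ℝ → ℝ → ℝ → ℝ :=
  fun x y t => deriv (fun s => G s y t) x

/-- Partial derivative in the second argument of a function of three real variables. -/
noncomputable def d2₁₅ (G : ℝ → ℝ → ℝ → ℝ) : ℝ → ℝ → ℝ → ℝ :=
  fun x y t => deriv (fun s => G x s t) y

/-- Partial derivative in the third argument of a function of three real variables. -/
noncomputable def d3₁₅ (G : ℝ → ℝ → ℝ → ℝ) : ℝ → ℝ → ℝ → ℝ :=
  fun x y t => deriv (fun s => G x y s) t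

/-- The operator `∂/∂x + ∂/∂y` on functions of `(x, y, t)`. -/
noncomputable def DXY₁₅ (G : ℝ → ℝ → ℝ → ℝ) : ℝ → ℝ → ℝ → ℝ :=
  fun x y t => d1₁₅ G x y t + d2₁₅ G x y t

/-- For a differentiable function of three variables, `∂/∂x + ∂/∂y` is the directional derivative
along `(1, 1, 0)`. -/
lemma DXY_eq_fderiv {G : ℝ → ℝ → ℝ → ℝ}
    (hG : Differentiable ℝ (fun q : ℝ × ℝ × ℝ => G q.1 q.2.1 q.2.2)) (x y t : ℝ) :
    DXY₁₅ G x y t =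
      fderiv ℝ (fun q : ℝ × ℝ × ℝ => G q.1 q.2.1 q.2.2) (x, y, t) (1, 1, 0) := by
  have hf := (hG (x, y, t)).hasFDerivAt
  have h1 : HasDerivAt (fun s => G s y t)
      (fderiv ℝ (fun q : ℝ × ℝ × ℝ => G q.1 q.2.1 q.2.2) (x, y, t) (1, 0, 0)) x :=
    hf.comp_hasDerivAt (f := fun s => (s, y, t)) x ((hasDerivAt_id x).prodMk
      ((hasDerivAt_const x y).prodMk (hasDerivAt_const x t)))
  have h2 : HasDerivAt (fun s => G x s t)
      (fderiv ℝ (fun q : ℝ × ℝ × ℝ => G q.1 q.2.1 q.2.2) (x, y, t) (0, 1, 0)) y :=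
    hf.comp_hasDerivAt (f := fun s => (x, s, t)) y ((hasDerivAt_const y x).prodMk
      ((hasDerivAt_id y).prodMk (hasDerivAt_const y t)))
  rw [DXY₁₅, d1₁₅, d2₁₅, h1.deriv, h2.deriv, ← map_add]
  simp

/-- The derivative of the diagonal restriction is the diagonal restriction of `∂/∂x + ∂/∂y`. -/
lemma hasDerivAt_diagonal {G : ℝ → ℝ → ℝ → ℝ}
    (hG : Differentiable ℝ (fun q : ℝ × ℝ × ℝ => G q.1 q.2.1 q.2.2)) (x t : ℝ) :
    HasDerivAt (fun s => G s s t) (DXY₁₅ G x x t) x := by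
  rw [DXY_eq_fderiv hG]
  exact (hG (x, x, t)).hasFDerivAt.comp_hasDerivAt x ((hasDerivAt_id x).prodMk
    ((hasDerivAt_id x).prodMk (hasDerivAt_const x t)))

lemma contDiff_DXY {G : ℝ → ℝ → ℝ → ℝ} {m n : WithTop ℕ∞}
    (hG : ContDiff ℝ n (fun q : ℝ × ℝ × ℝ => G q.1 q.2.1 q.2.2)) (hmn : m + 1 ≤ n) :
    ContDiff ℝ m (fun q : ℝ × ℝ × ℝ => DXY₁₅ G q.1 q.2.1 q.2.2) := by
  have hd : Differentiable ℝ (fun q : ℝ × ℝ × ℝ => G q.1 q.2.1 q.2.2) :=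
    (hG.of_le (le_add_self.trans hmn)).differentiable one_ne_zero
  simp only [DXY_eq_fderiv hd]
  exact (hG.fderiv_right hmn).clm_apply contDiff_const

/-- The partial derivatives of a differentiable function of two real variables. -/
lemma Differentiable.hasDerivAt_partial {E : Type*} [NormedAddCommGroup E] [NormedSpace ℝ E]
    {f : ℝ × ℝ → E} (hf : Differentiable ℝ f) (a b : ℝ) :
    HasDerivAt (fun s => f (s, b)) (fderiv ℝ f (a, b) (1, 0)) a ∧
      HasDerivAt (fun s => f (a, s)) (fderiv ℝ f (a, b) (0, 1)) b :=
  ⟨(hf (a, b)).hasFDerivAt.comp_hasDerivAt a ((hasDerivAt_id a).prodMk (hasDerivAt_const a b)),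
    (hf (a, b)).hasFDerivAt.comp_hasDerivAt b ((hasDerivAt_const b a).prodMk (hasDerivAt_id b))⟩

/-- Mixed partial derivatives of a `C²` function of two variables commute. -/
lemma hasDerivAt_deriv_of_contDiff_two {f : ℝ × ℝ → ℝ} (hf : ContDiff ℝ 2 f) (x t : ℝ) :
    HasDerivAt (fun s => deriv (fun τ => f (s, τ)) t)
      (deriv (fun τ => deriv (fun s => f (s, τ)) x) t) x := by
  have hd : Differentiable ℝ f := hf.differentiable two_ne_zero
  have hd' : Differentiable ℝ (fderiv ℝ f) :=
    (hf.fderiv_right (m := 1) (by norm_num)).differentiable one_ne_zero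
  have h1 (a b : ℝ) : deriv (fun s => f (s, b)) a = fderiv ℝ f (a, b) (1, 0) :=
    (hd.hasDerivAt_partial a b).1.deriv
  have h2 (a b : ℝ) : deriv (fun τ => f (a, τ)) b = fderiv ℝ f (a, b) (0, 1) :=
    (hd.hasDerivAt_partial a b).2.deriv
  have h12 : HasDerivAt (fun τ => fderiv ℝ f (x, τ) (1, 0))
      (fderiv ℝ (fderiv ℝ f) (x, t) (0, 1) (1, 0)) t := by
    simpa using (hd'.hasDerivAt_partial x t).2.clm_apply (hasDerivAt_const t ((1, 0) : ℝ × ℝ))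
  have h21 : HasDerivAt (fun s => fderiv ℝ f (s, t) (0, 1))
      (fderiv ℝ (fderiv ℝ f) (x, t) (1, 0) (0, 1)) x := by
    simpa using (hd'.hasDerivAt_partial x t).1.clm_apply (hasDerivAt_const x ((0, 1) : ℝ × ℝ))
  have hsymm : IsSymmSndFDerivAt ℝ f (x, t) := hf.contDiffAt.isSymmSndFDerivAt (by simp)
  simp only [h1, h2, h12.deriv, hsymm.eq (0, 1) (1, 0)]
  exact h21

/-- Passage from equation (23) to the Korteweg–de Vries equation (24): if `K(x,y,t)` is `C⁴`
and satisfies `K_t + (∂ₓ+∂ᵧ)³K + 6 ((∂ₓ+∂ᵧ)K)·(d/dx)K(x,x,t) = 0`, then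
`u(x,t) = 2·(d/dx)K(x,x,t)` satisfies `u_t + 3(u²)_x + u_xxx = 0`,
i.e. `u_t + 6 u u_x + u_xxx = 0`. -/
theorem stmt_15 (K : ℝ → ℝ → ℝ → ℝ)
    (hK : ContDiff ℝ 4 (fun q : ℝ × ℝ × ℝ => K q.1 q.2.1 q.2.2))
    (heq : ∀ x y t : ℝ,
      d3₁₅ K x y t + DXY₁₅ (DXY₁₅ (DXY₁₅ K)) x y t
        + 6 * DXY₁₅ K x y t * deriv (fun s => K s s t) x = 0)
    (u : ℝ → ℝ → ℝ)
    (hu : ∀ x t : ℝ, u x t = 2 * deriv (fun s => K s s t) x) :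
    ∀ x t : ℝ,
      (deriv (fun τ => u x τ) t + 3 * deriv (fun s => (u s t) ^ 2) x
          + deriv^[3] (fun s => u s t) x = 0)
      ∧ (deriv (fun τ => u x τ) t + 6 * u x t * deriv (fun s => u s t) x
          + deriv^[3] (fun s => u s t) x = 0) := by
  intro x t
  have c1 := contDiff_DXY (m := 3) hK (by norm_num)
  have c2 := contDiff_DXY (m := 2) c1 (by norm_num)
  have c3 := contDiff_DXY (m := 1) c2 (by norm_num)
  have k0 := hasDerivAt_diagonal (hK.differentiable (by norm_num))
  have k1 := hasDerivAt_diagonal (c1.differentiable (by norm_num))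
  have k2 := hasDerivAt_diagonal (c2.differentiable (by norm_num))
  have k3 := hasDerivAt_diagonal (c3.differentiable (by norm_num))
  have hu' : u = fun x t => 2 * DXY₁₅ K x x t := by
    funext x t
    rw [hu, (k0 x t).deriv]
  have hux (x : ℝ) : HasDerivAt (fun s => u s t) (2 * DXY₁₅ (DXY₁₅ K) x x t) x := by
    simpa only [hu'] using (k1 x t).const_mul 2
  have hu3 : deriv^[3] (fun s => u s t) x = 2 * DXY₁₅ (DXY₁₅ (DXY₁₅ (DXY₁₅ K))) x x t := by
    have e1 : deriv (fun s => u s t) = fun s => 2 * DXY₁₅ (DXY₁₅ K) s s t :=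
      funext fun s => (hux s).deriv
    have e2 : deriv (fun s => 2 * DXY₁₅ (DXY₁₅ K) s s t) =
        fun s => 2 * DXY₁₅ (DXY₁₅ (DXY₁₅ K)) s s t :=
      funext fun s => ((k2 s t).const_mul 2).deriv
    simp only [Function.iterate_succ, Function.iterate_zero, Function.comp_apply, id, e1, e2]
    exact ((k3 x t).const_mul 2).deriv
  have hmixed := hasDerivAt_deriv_of_contDiff_two (f := fun p => K p.1 p.1 p.2)
    ((hK.of_le (by norm_num)).comp
      (contDiff_fst.prodMk (contDiff_fst.prodMk contDiff_snd))) x t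
  have hut : deriv (fun τ => u x τ) t =
      2 * deriv (fun τ => deriv (fun s => K s s τ) x) t := by
    simp only [hu]
    exact deriv_const_mul_field _
  have hdiag : (fun s => deriv (fun τ => K s s τ) t) =
      fun s => -(DXY₁₅ (DXY₁₅ (DXY₁₅ K)) s s t + 6 * DXY₁₅ K s s t ^ 2) := by
    funext s
    have h := heq s s t
    rw [(k0 s t).deriv, d3₁₅] at h
    linear_combination h
  rw [hdiag] at hmixed
  have hkdv := hmixed.unique ((k3 x t).add (((k1 x t).pow 2).const_mul 6)).neg
  have hsq : deriv (fun s => u s t ^ 2) x = 2 * u x t * deriv (fun s => u s t) x := by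
    simpa [(hux x).deriv] using ((hux x).fun_pow 2).deriv
  have hmain : deriv (fun τ => u x τ) t + 6 * u x t * deriv (fun s => u s t) x
      + deriv^[3] (fun s => u s t) x = 0 := by
    rw [hut, hu3, (hux x).deriv, hkdv, hu']
    push_cast
    ring
  refine ⟨?_, hmain⟩
  rw [hsq]
  linear_combination hmain
end

section
/- Let v : ℝ × ℝ → ℝ, written v(x,t), be three times continuously differentiable and satisfy the modified Korteweg–de Vries equation ∂v/∂t + ∂³v/∂x³ − 6 v² ∂v/∂x = 0. Then the Miura transform g := −v² − ∂v/∂x satisfies the Korteweg–de Vries equation ∂g/∂t + 6 g ∂g/∂x + ∂³g/∂x³ = 0. -/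
theorem hasDerivAt_slice_fst {G : ℝ × ℝ → ℝ} (hG : Differentiable ℝ G) (x t : ℝ) :
    HasDerivAt (fun s => G (s, t)) (fderiv ℝ G (x, t) (1, 0)) x :=
  (hG (x, t)).hasFDerivAt.comp_hasDerivAt x ((hasDerivAt_id x).prodMk (hasDerivAt_const x t))

theorem hasDerivAt_slice_snd {G : ℝ × ℝ → ℝ} (hG : Differentiable ℝ G) (x t : ℝ) :
    HasDerivAt (fun τ => G (x, τ)) (fderiv ℝ G (x, t) (0, 1)) t :=
  (hG (x, t)).hasFDerivAt.comp_hasDerivAt t ((hasDerivAt_const t x).prodMk (hasDerivAt_id t))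

/-- Equality of mixed directional derivatives of a `C²` function. -/
theorem fderiv_fderiv_apply_comm {E : Type*} [NormedAddCommGroup E] [NormedSpace ℝ E]
    {G : E → ℝ} (hG : ContDiff ℝ 2 G) (p a b : E) :
    fderiv ℝ (fun q => fderiv ℝ G q a) p b = fderiv ℝ (fun q => fderiv ℝ G q b) p a := by
  have hd : DifferentiableAt ℝ (fderiv ℝ G) p :=
    (hG.fderiv_right (m := 1) (by norm_num)).differentiable (by norm_num) p
  have hsymm : IsSymmSndFDerivAt ℝ G p := hG.contDiffAt.isSymmSndFDerivAt (by simp)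
  rw [fderiv_clm_apply hd (by fun_prop), fderiv_clm_apply hd (by fun_prop)]
  simpa using hsymm.eq b a

/-- Miura's transform: if `v(x,t)` is `C³` and solves the modified Korteweg–de Vries equation
`v_t + v_xxx − 6 v² v_x = 0`, then `g = −v² − v_x` solves the Korteweg–de Vries equation
`g_t + 6 g g_x + g_xxx = 0`. -/
theorem stmt_17 (v : ℝ → ℝ → ℝ)
    (hv : ContDiff ℝ 3 (fun q : ℝ × ℝ => v q.1 q.2))
    (hmkdv : ∀ x t : ℝ,
      deriv (fun τ => v x τ) t + deriv^[3] (fun s => v s t) x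
        - 6 * (v x t) ^ 2 * deriv (fun s => v s t) x = 0)
    (g : ℝ → ℝ → ℝ)
    (hg : ∀ x t : ℝ, g x t = -(v x t) ^ 2 - deriv (fun s => v s t) x) :
    ∀ x t : ℝ,
      deriv (fun τ => g x τ) t + 6 * g x t * deriv (fun s => g s t) x
        + deriv^[3] (fun s => g s t) x = 0 := by
  set F : ℝ × ℝ → ℝ := fun q => v q.1 q.2
  set A : ℝ × ℝ → ℝ := fun q => fderiv ℝ F q (1, 0)
  set B : ℝ × ℝ → ℝ := fun q => fderiv ℝ F q (0, 1)
  set C : ℝ × ℝ → ℝ := fun q => fderiv ℝ A q (1, 0)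
  have cF' : ContDiff ℝ 2 (fderiv ℝ F) := hv.fderiv_right (by norm_num)
  have cA : ContDiff ℝ 2 A := cF'.clm_apply contDiff_const
  have cB : ContDiff ℝ 2 B := cF'.clm_apply contDiff_const
  have cC : ContDiff ℝ 1 C :=
    (cA.fderiv_right (m := 1) (by norm_num)).clm_apply contDiff_const
  have dF : Differentiable ℝ F := hv.differentiable (by norm_num)
  have dA : Differentiable ℝ A := cA.differentiable (by norm_num)
  have dB : Differentiable ℝ B := cB.differentiable (by norm_num)
  have dC : Differentiable ℝ C := cC.differentiable (by norm_num)
  have vx (x t : ℝ) : HasDerivAt (fun s => v s t) (A (x, t)) x := hasDerivAt_slice_fst dF x t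
  have vt (x t : ℝ) : HasDerivAt (fun τ => v x τ) (B (x, t)) t := hasDerivAt_slice_snd dF x t
  have vxx (x t : ℝ) : HasDerivAt (fun s => A (s, t)) (C (x, t)) x := hasDerivAt_slice_fst dA x t
  have vxt (x t : ℝ) : HasDerivAt (fun τ => A (x, τ)) (fderiv ℝ B (x, t) (1, 0)) t := by
    rw [fderiv_fderiv_apply_comm (hv.of_le (by norm_num)) (x, t) (0, 1) (1, 0)]
    exact hasDerivAt_slice_snd dA x t
  have vtx (x t : ℝ) : HasDerivAt (fun s => B (s, t)) (fderiv ℝ B (x, t) (1, 0)) x :=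
    hasDerivAt_slice_fst dB x t
  have dvx (t : ℝ) : deriv (fun s => v s t) = fun x => A (x, t) := funext fun x => (vx x t).deriv
  have dvxx (t : ℝ) : deriv (fun s => A (s, t)) = fun x => C (x, t) :=
    funext fun x => (vxx x t).deriv
  -- The equation itself expresses the third derivative through `C¹` quantities.
  have vxxx (x t : ℝ) :
      HasDerivAt (fun s => C (s, t)) (-B (x, t) + 6 * v x t ^ 2 * A (x, t)) x := by
    have h := hmkdv x t
    simp only [Function.iterate_succ, Function.iterate_zero, Function.comp_apply, id_eq, dvx,
      dvxx, (vt x t).deriv] at h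
    have hd := hasDerivAt_slice_fst dC x t
    rw [hd.deriv] at h
    convert hd using 1
    linarith
  have hgt (t : ℝ) : (fun s => g s t) = fun x => -v x t ^ 2 - A (x, t) := by
    funext x
    rw [hg, dvx]
  have gt (x t : ℝ) : HasDerivAt (fun τ => g x τ)
      (-(2 * v x t * B (x, t)) - fderiv ℝ B (x, t) (1, 0)) t := by
    have e : (fun τ => g x τ) = fun τ => -v x τ ^ 2 - A (x, τ) := by
      funext τ
      rw [hg, dvx]
    rw [e]
    exact (((vt x t).fun_pow 2).fun_neg.fun_sub (vxt x t)).congr_deriv (by norm_num)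
  have gx (t : ℝ) : deriv (fun s => g s t) = fun x => -(2 * v x t * A (x, t)) - C (x, t) := by
    funext x
    rw [hgt]
    exact ((((vx x t).fun_pow 2).fun_neg.fun_sub (vxx x t)).congr_deriv
      (by norm_num)).deriv
  have gxx (t : ℝ) : deriv (fun x => -(2 * v x t * A (x, t)) - C (x, t)) = fun x =>
      -(2 * A (x, t) ^ 2 + 2 * v x t * C (x, t)) - (-B (x, t) + 6 * v x t ^ 2 * A (x, t)) := by
    funext x
    exact (((((vx x t).const_mul 2).fun_mul (vxx x t)).fun_neg.fun_sub (vxxx x t)).congr_deriv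
      (by ring)).deriv
  have gxxx (x t : ℝ) := ((((vxx x t).fun_pow 2).const_mul 2).fun_add
    (((vx x t).const_mul 2).fun_mul (vxxx x t))).fun_neg.fun_sub
    ((vtx x t).fun_neg.fun_add ((((vx x t).fun_pow 2).const_mul 6).fun_mul (vxx x t)))
  intro x t
  simp only [Function.iterate_succ, Function.iterate_zero, Function.comp_apply, id_eq, gx, gxx,
    (gt x t).deriv, (gxxx x t).deriv, hg x t, dvx]
  norm_num
  ring
end
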